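/- Let ∅ ≠ E ⊂ X be a closed and porous set, let α > 0, and set w = δ_E^{-α}. Then the following three conditions are equivalent: (A) codim_A(E) > α; (B) w belongs to the Muckenhoupt class A_1; (C) w belongs to the Muckenhoupt class A_q for some 1 < q < ∞. -/

import Mathlib

open MeasureTheory Metric Set
open scoped ENNReal NNReal

namespace ApDistance

noncomputable section
set_option linter.deprecated false
set_option linter.unusedSectionVars false

variable {X : Type*} [MetricSpace X] [MeasurableSpace X] [BorelSpace X]

/-- All balls of positive radius have positive and finite measure. -/
def BallsPosFinite (μ : Measure X) : Prop :=
  ∀ (x : X) (r : ℝ), 0 < r → 0 < μ (ball x r) ∧ μ (ball x r) < ∞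

/-- The measure `μ` is doubling with constant `C`. -/
def DoublingWith (μ : Measure X) (C : ℝ) : Prop :=
  ∀ (x : X) (r : ℝ), 0 < r → μ (ball x (2 * r)) ≤ ENNReal.ofReal C * μ (ball x r)

/-- The measure `μ` is doubling. -/
def Doubling (μ : Measure X) : Prop :=
  ∃ C : ℝ, 0 < C ∧ DoublingWith μ C

/-- The (quantitative) reverse doubling condition with exponent `η`. -/
def ReverseDoubling (μ : Measure X) (η : ℝ) : Prop :=
  ∃ C : ℝ, 0 < C ∧ ∀ (x y : X) (r R : ℝ), 0 < r → 0 < R → ball y r ⊆ ball x R →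
    μ (ball y r) ≤ ENNReal.ofReal (C * (r / R) ^ η) * μ (ball x R)

/-- Standing assumptions (S1)-(S2): `X` is unbounded, points have measure zero,
and all annuli are nonempty. -/
def StandingAssumptions (μ : Measure X) : Prop :=
  ¬ Bornology.IsBounded (univ : Set X) ∧ (∀ x : X, μ {x} = 0) ∧
    ∀ (x : X) (r R : ℝ), 0 < r → r < R → (ball x R \ ball x r).Nonempty

/-- Ahlfors `Q`-regularity of the metric measure space. -/
def AhlforsRegular (μ : Measure X) (Q : ℝ) : Prop :=
  ∃ C : ℝ, 1 ≤ C ∧ ∀ (x : X) (r : ℝ), 0 < r → ENNReal.ofReal r < EMetric.diam (univ : Set X) →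
    ENNReal.ofReal (C⁻¹ * r ^ Q) ≤ μ (ball x r) ∧ μ (ball x r) ≤ ENNReal.ofReal (C * r ^ Q)

/-- The set of admissible exponents in the definition of the (upper) Assouad dimension:
`E ∩ B(x,R)` can be covered by at most `C (R/r)^s` balls of radius `r`. -/
def assouadDimBddSet (E : Set X) : Set ℝ :=
  {s : ℝ | 0 ≤ s ∧ ∃ C : ℝ, 1 ≤ C ∧ ∀ x ∈ E, ∀ r R : ℝ, 0 < r → r < R →
    ENNReal.ofReal R < 2 * EMetric.diam (univ : Set X) →
    ∃ F : Finset X, (F.card : ℝ) ≤ C * (R / r) ^ s ∧ E ∩ ball x R ⊆ ⋃ y ∈ F, ball y r}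

/-- The (upper) Assouad dimension of a set `E`. -/
def assouadDim (E : Set X) : ℝ := sInf (assouadDimBddSet E)

/-- The set of admissible exponents in the definition of the lower Assouad codimension. -/
def assouadCodimBddSet (μ : Measure X) (E : Set X) : Set ℝ :=
  {ρ : ℝ | 0 ≤ ρ ∧ ∃ C : ℝ, 1 ≤ C ∧ ∀ x ∈ E, ∀ r R : ℝ, 0 < r → r < R →
    ENNReal.ofReal R < 2 * EMetric.diam (univ : Set X) →
    μ ({y : X | infDist y E < r} ∩ ball x R) ≤
      ENNReal.ofReal (C * (r / R) ^ ρ) * μ (ball x R)}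

/-- The lower Assouad codimension of a set `E` with respect to `μ`. -/
def assouadCodim (μ : Measure X) (E : Set X) : ℝ := sSup (assouadCodimBddSet μ E)

/-- Porosity of a set `E ⊆ X`. -/
def IsPorous (E : Set X) : Prop :=
  ∃ c : ℝ, 0 < c ∧ c < 1 ∧ ∀ x ∈ E, ∀ r : ℝ, 0 < r →
    ENNReal.ofReal r < 2 * EMetric.diam (univ : Set X) →
    ∃ y : X, ball y (c * r) ⊆ ball x r \ E

/-- A weight: measurable, a.e. positive and finite, locally integrable on balls. -/
def IsWeight (μ : Measure X) (w : X → ℝ≥0∞) : Prop :=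
  Measurable w ∧ (∀ᵐ x ∂μ, 0 < w x ∧ w x ≠ ∞) ∧
    ∀ (x : X) (r : ℝ), 0 < r → ∫⁻ y in ball x r, w y ∂μ ≠ ∞

/-- Membership in the Muckenhoupt class `A_p`, `1 < p < ∞`. -/
def MemAp (μ : Measure X) (w : X → ℝ≥0∞) (p : ℝ) : Prop :=
  IsWeight μ w ∧ ∃ A : ℝ, 0 < A ∧ ∀ (x : X) (r : ℝ), 0 < r →
    ((∫⁻ y in ball x r, w y ∂μ) / μ (ball x r)) *
      ((∫⁻ y in ball x r, w y ^ (-(1 / (p - 1))) ∂μ) / μ (ball x r)) ^ (p - 1) ≤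
      ENNReal.ofReal A

/-- Membership in the Muckenhoupt class `A_1`. -/
def MemA1 (μ : Measure X) (w : X → ℝ≥0∞) : Prop :=
  IsWeight μ w ∧ ∃ A : ℝ, 0 < A ∧ ∀ (x : X) (r : ℝ), 0 < r →
    ((∫⁻ y in ball x r, w y ∂μ) / μ (ball x r)) *
      essSup (fun y => (w y)⁻¹) (μ.restrict (ball x r)) ≤ ENNReal.ofReal A

/-- Membership in the Muckenhoupt class `A_∞`. -/
def MemAinfty (μ : Measure X) (w : X → ℝ≥0∞) : Prop :=
  IsWeight μ w ∧ ∃ C d : ℝ, 0 < C ∧ 0 < d ∧ ∀ (x : X) (r : ℝ), 0 < r →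
    ∀ F : Set X, MeasurableSet F → F ⊆ ball x r →
      ∫⁻ y in F, w y ∂μ ≤
        ENNReal.ofReal C * (μ F / μ (ball x r)) ^ d * ∫⁻ y in ball x r, w y ∂μ

/-- The weight `w = δ_E^{-α} = dist(·,E)^{-α}` (with values in `ℝ≥0∞`). -/
def distWeight (E : Set X) (α : ℝ) : X → ℝ≥0∞ :=
  fun x => ENNReal.ofReal (infDist x E) ^ (-α)

/-- The Aikawa condition with exponent `α` and constant `C`. -/
def AikawaCondition (μ : Measure X) (E : Set X) (α C : ℝ) : Prop :=
  ∀ x ∈ E, ∀ r : ℝ, 0 < r → ENNReal.ofReal r < 2 * EMetric.diam (univ : Set X) →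
    ∫⁻ y in ball x r, ENNReal.ofReal (infDist y E) ^ (-α) ∂μ ≤
      ENNReal.ofReal (C * r ^ (-α)) * μ (ball x r)

/-- The Riesz potential `I_s f`. -/
def rieszPotential (μ : Measure X) (s : ℝ) (f : X → ℝ≥0∞) (x : X) : ℝ≥0∞ :=
  ∫⁻ y, f y * ENNReal.ofReal (dist x y ^ s) / μ (ball x (dist x y)) ∂μ

/-- `Lip_0(X)`: Lipschitz functions vanishing outside some ball. -/
def MemLip0 (f : X → ℝ) : Prop :=
  (∃ K : ℝ≥0, LipschitzWith K f) ∧ ∃ (x : X) (r : ℝ), ∀ y : X, y ∉ ball x r → f y = 0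

/-- The `λ`-chain condition. -/
def ChainCondition (X : Type*) [MetricSpace X] (lam : ℝ) : Prop :=
  ∃ M : ℝ, 1 ≤ M ∧ ∀ (x : X) (r R : ℝ), 0 < r → r < R →
    ∃ (k : ℕ) (c : ℕ → X) (ρ : ℕ → ℝ),
      (∀ i ≤ k, 0 < ρ i) ∧
      ball (c 0) (lam * ρ 0) ⊆ (ball x R)ᶜ ∧
      ball (c k) (lam * ρ k) ⊆ ball x r ∧
      (∀ i ≤ k,
        M⁻¹ * Metric.diam (ball (c i) (lam * ρ i)) ≤ infDist x (ball (c i) (lam * ρ i)) ∧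
        infDist x (ball (c i) (lam * ρ i)) ≤ M * Metric.diam (ball (c i) (lam * ρ i))) ∧
      (∀ i < k, ∃ (z : X) (t : ℝ), 0 < t ∧
        ball z t ⊆ ball (c i) (ρ i) ∩ ball (c (i + 1)) (ρ (i + 1)) ∧
        ball (c i) (ρ i) ∪ ball (c (i + 1)) (ρ (i + 1)) ⊆ ball z (M * t)) ∧
      (∀ y : X, (({i : ℕ | i ≤ k ∧ y ∈ ball (c i) (lam * ρ i)}).ncard : ℝ) ≤ M)

/-- The inner integral appearing in fractional Hardy–Sobolev inequalities:
`y ↦ ∫_X |f(y)-f(z)|^t / (d(y,z)^{st} μ(B(y,d(y,z)))) dμ(z)`. -/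
def fracEnergyKernel (μ : Measure X) (s t : ℝ) (f : X → ℝ) (y : X) : ℝ≥0∞ :=
  ∫⁻ z, ENNReal.ofReal (|f y - f z| ^ t) /
    (ENNReal.ofReal (dist y z ^ (s * t)) * μ (ball y (dist y z))) ∂μ


lemma doubling_pow {μ : Measure X} {C : ℝ} (h : DoublingWith μ C) (n : ℕ) (x : X) {r : ℝ}
    (hr : 0 < r) : μ (ball x (2 ^ n * r)) ≤ ENNReal.ofReal C ^ n * μ (ball x r) := by
  induction n with
  | zero => simp
  | succ n ih =>
    have h1 := h x (2 ^ n * r) (by positivity)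
    have e : (2 : ℝ) ^ (n + 1) * r = 2 * (2 ^ n * r) := by ring
    rw [e, pow_succ']
    calc _ ≤ _ := h1
      _ ≤ ENNReal.ofReal C * (ENNReal.ofReal C ^ n * μ (ball x r)) := by gcongr
      _ = _ := by ring

lemma ennreal_rpow_anti {a b : ℝ≥0∞} (h : a ≤ b) {t : ℝ} (ht : 0 ≤ t) : b ^ (-t) ≤ a ^ (-t) := by
  rw [ENNReal.rpow_neg, ENNReal.rpow_neg, ENNReal.inv_le_inv]
  exact ENNReal.rpow_le_rpow h ht

lemma dw_le {E : Set X} {α : ℝ} (hα : 0 < α) {t : ℝ} {y : X} (h : t ≤ infDist y E) :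
    distWeight E α y ≤ ENNReal.ofReal t ^ (-α) :=
  ennreal_rpow_anti (ENNReal.ofReal_le_ofReal h) hα.le

lemma le_dw {E : Set X} {α : ℝ} (hα : 0 < α) {t : ℝ} {y : X} (h : infDist y E ≤ t) :
    ENNReal.ofReal t ^ (-α) ≤ distWeight E α y :=
  ennreal_rpow_anti (ENNReal.ofReal_le_ofReal h) hα.le

lemma measurable_dw (E : Set X) (α : ℝ) : Measurable (distWeight E α) := by
  unfold distWeight
  exact (measurable_infDist.ennreal_ofReal).pow_const _

lemma dw_pos {E : Set X} {α : ℝ} (hα : 0 < α) (y : X) : 0 < distWeight E α y := by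
  unfold distWeight
  rw [ENNReal.rpow_neg, ENNReal.inv_pos]
  exact ENNReal.rpow_ne_top_of_nonneg hα.le ENNReal.ofReal_ne_top

lemma porous_ball {μ : Measure X} (hdbl : Doubling μ)
    {E : Set X} (hE : E.Nonempty) (hpor : IsPorous E) :
    ∃ l : ℝ, 0 < l ∧ l ≤ 1 / 2 ∧ ∃ K : ℝ≥0∞, K ≠ 0 ∧ K ≠ ∞ ∧ ∀ x ∈ E, ∀ s : ℝ, 0 < s →
      ENNReal.ofReal s < 2 * EMetric.diam (univ : Set X) →
      ∃ y : X, ball y (l * s) ⊆ ball x s ∧ (∀ z ∈ ball y (l * s), l * s ≤ infDist z E) ∧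
        μ (ball x (16 * s)) ≤ K * μ (ball y (l * s)) := by
  obtain ⟨c, hc0, hc1, hc⟩ := hpor
  obtain ⟨C, hC0, hC⟩ := hdbl
  obtain ⟨n, hn⟩ := pow_unbounded_of_one_lt (17 / (c / 2)) (one_lt_two (α := ℝ))
  refine ⟨c / 2, by positivity, by linarith, ENNReal.ofReal C ^ n, ?_, ?_, ?_⟩
  · exact pow_ne_zero _ (by simpa using hC0)
  · exact ENNReal.pow_ne_top ENNReal.ofReal_ne_top
  intro x hx s hs hsd
  obtain ⟨y, hy⟩ := hc x hx s hs hsd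
  have hcs : 0 < c * s := by positivity
  have hsub : ball y (c / 2 * s) ⊆ ball y (c * s) := ball_subset_ball (by nlinarith)
  refine ⟨y, fun z hz => (hy (hsub hz)).1, ?_, ?_⟩
  · intro z hz
    by_contra! hlt
    obtain ⟨e, he, hze⟩ := (infDist_lt_iff hE).1 hlt
    refine (hy (a := e) ?_).2 he
    rw [mem_ball] at hz ⊢
    have := dist_triangle e z y
    rw [dist_comm e z] at this
    linarith
  · have hyx : dist y x < s := (hy (mem_ball_self hcs)).1
    refine le_trans (measure_mono ?_) (doubling_pow hC n y (by positivity))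
    rw [div_lt_iff₀ (by positivity)] at hn
    refine ball_subset_ball' ?_
    rw [dist_comm]
    nlinarith

lemma aikawa_of_Ap {μ : Measure X} (hballs : BallsPosFinite μ) {E : Set X} {α q : ℝ} (hα : 0 < α)
    (hq : 1 < q) (hA : MemAp μ (distWeight E α) q)
    {l : ℝ} (hl : 0 < l) {K : ℝ≥0∞} (hK0 : K ≠ 0) (hK : K ≠ ∞)
    (h : ∀ x ∈ E, ∀ s : ℝ, 0 < s →
      ENNReal.ofReal s < 2 * EMetric.diam (univ : Set X) →
      ∃ y : X, ball y (l * s) ⊆ ball x s ∧ (∀ z ∈ ball y (l * s), l * s ≤ infDist z E) ∧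
        μ (ball x (16 * s)) ≤ K * μ (ball y (l * s))) :
    ∃ C : ℝ≥0∞, C ≠ 0 ∧ C ≠ ∞ ∧ ∀ x ∈ E, ∀ s : ℝ, 0 < s →
      ENNReal.ofReal s < 2 * EMetric.diam (univ : Set X) →
      ∫⁻ y in ball x (16 * s), distWeight E α y ∂μ ≤
        C * ENNReal.ofReal s ^ (-α) * μ (ball x (16 * s)) := by
  obtain ⟨-, A, hA0, hA⟩ := hA
  have hq1 : 0 < q - 1 := by linarith
  have hl0 : ENNReal.ofReal l ≠ 0 := by simpa using hl
  have hKq0 : K ^ (q - 1) ≠ 0 := (ENNReal.rpow_pos (pos_iff_ne_zero.2 hK0) hK).ne'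
  have hKq : K ^ (q - 1) ≠ ∞ := ENNReal.rpow_ne_top_of_nonneg hq1.le hK
  have hll0 : ENNReal.ofReal l ^ (-α) ≠ 0 :=
    (ENNReal.rpow_pos (pos_iff_ne_zero.2 hl0) ENNReal.ofReal_ne_top).ne'
  have hll : ENNReal.ofReal l ^ (-α) ≠ ∞ := by
    rw [ENNReal.ofReal_rpow_of_pos hl]; exact ENNReal.ofReal_ne_top
  have hAA : ENNReal.ofReal A ≠ 0 := by simpa using hA0
  refine ⟨ENNReal.ofReal A * K ^ (q - 1) * ENNReal.ofReal l ^ (-α), ?_, ?_, ?_⟩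
  · exact mul_ne_zero (mul_ne_zero hAA hKq0) hll0
  · exact ENNReal.mul_ne_top (ENNReal.mul_ne_top ENNReal.ofReal_ne_top hKq) hll
  intro x hx s hs hsd
  obtain ⟨y, hy1, hy2, hy3⟩ := h x hx s hs hsd
  have hm := hballs x (16 * s) (by positivity)
  have hv := hballs y (l * s) (by positivity)
  have hAB := hA x (16 * s) (by positivity)
  set m := μ (ball x (16 * s)) with hmdef
  set v := μ (ball y (l * s)) with hvdef
  set P := ∫⁻ y in ball x (16 * s), distWeight E α y ∂μ with hP
  set T : ℝ≥0∞ := ENNReal.ofReal (l * s) ^ (-α) with hT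
  have hTpos : T ≠ 0 := by
    rw [hT, ENNReal.ofReal_rpow_of_pos (by positivity)]
    simp only [ne_eq, ENNReal.ofReal_eq_zero, not_le]; positivity
  have hTtop : T ≠ ∞ := by
    rw [hT, ENNReal.ofReal_rpow_of_pos (by positivity)]; exact ENNReal.ofReal_ne_top
  have hp : 0 < 1 / (q - 1) := by positivity
  have h1 : T ^ (-(1 / (q - 1))) * v ≤
      ∫⁻ y in ball x (16 * s), distWeight E α y ^ (-(1 / (q - 1))) ∂μ := by
    calc _ = ∫⁻ _ in ball y (l * s), T ^ (-(1 / (q - 1))) ∂μ := by rw [setLIntegral_const]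
      _ ≤ ∫⁻ z in ball y (l * s), distWeight E α z ^ (-(1 / (q - 1))) ∂μ := by
          refine setLIntegral_mono' measurableSet_ball fun z hz => ?_
          exact ennreal_rpow_anti (dw_le hα (hy2 z hz)) hp.le
      _ ≤ _ := by
          refine lintegral_mono_set ?_
          exact hy1.trans (ball_subset_ball (by linarith))
  have h2 : K⁻¹ * T ^ (-(1 / (q - 1))) ≤
      (∫⁻ y in ball x (16 * s), distWeight E α y ^ (-(1 / (q - 1))) ∂μ) / m := by
    rw [ENNReal.le_div_iff_mul_le (Or.inl hm.1.ne') (Or.inl hm.2.ne)]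
    refine le_trans ?_ h1
    calc K⁻¹ * T ^ (-(1 / (q - 1))) * m ≤ K⁻¹ * T ^ (-(1 / (q - 1))) * (K * v) := by gcongr
      _ = (K⁻¹ * K) * (T ^ (-(1 / (q - 1))) * v) := by ring
      _ = _ := by rw [ENNReal.inv_mul_cancel hK0 hK, one_mul]
  have h3 : (K ^ (q - 1))⁻¹ * T⁻¹ ≤
      ((∫⁻ y in ball x (16 * s), distWeight E α y ^ (-(1 / (q - 1))) ∂μ) / m) ^ (q - 1) := by
    refine le_trans (le_of_eq ?_) (ENNReal.rpow_le_rpow h2 hq1.le)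
    rw [ENNReal.mul_rpow_of_nonneg _ _ hq1.le, ENNReal.inv_rpow, ← ENNReal.rpow_mul]
    have : -(1 / (q - 1)) * (q - 1) = -1 := by field_simp
    rw [this, ENNReal.rpow_neg_one]
  have h4 : P / m * ((K ^ (q - 1))⁻¹ * T⁻¹) ≤ ENNReal.ofReal A :=
    le_trans (by gcongr) hAB
  have hTs : T = ENNReal.ofReal l ^ (-α) * ENNReal.ofReal s ^ (-α) := by
    rw [hT, ENNReal.ofReal_mul hl.le, ENNReal.mul_rpow_of_ne_top ENNReal.ofReal_ne_top
      ENNReal.ofReal_ne_top]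
  calc P = (P / m * ((K ^ (q - 1))⁻¹ * T⁻¹)) * (K ^ (q - 1) * T * m) := by
        have e : (P / m * ((K ^ (q - 1))⁻¹ * T⁻¹)) * (K ^ (q - 1) * T * m) =
          (P / m * m) * ((K ^ (q - 1))⁻¹ * K ^ (q - 1)) * (T⁻¹ * T) := by ring
        rw [e, ENNReal.inv_mul_cancel hTpos hTtop, ENNReal.inv_mul_cancel hKq0 hKq,
          ENNReal.div_mul_cancel hm.1.ne' hm.2.ne, mul_one, mul_one]
    _ ≤ ENNReal.ofReal A * (K ^ (q - 1) * T * m) := by gcongr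
    _ = _ := by rw [hTs]; ring

/-- Hole filling inequality. -/
lemma hole_fill {μ : Measure X} (hballs : BallsPosFinite μ) {E : Set X} (hE : E.Nonempty)
    {α : ℝ} (hα : 0 < α)
    {l : ℝ} (hl : 0 < l) {K : ℝ≥0∞}
    (h : ∀ x ∈ E, ∀ s : ℝ, 0 < s →
      ENNReal.ofReal s < 2 * EMetric.diam (univ : Set X) →
      ∃ y : X, ball y (l * s) ⊆ ball x s ∧ (∀ z ∈ ball y (l * s), l * s ≤ infDist z E) ∧
        μ (ball x (16 * s)) ≤ K * μ (ball y (l * s)))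
    {C : ℝ≥0∞}
    (hC : ∀ x ∈ E, ∀ s : ℝ, 0 < s →
      ENNReal.ofReal s < 2 * EMetric.diam (univ : Set X) →
      ∫⁻ y in ball x (16 * s), distWeight E α y ∂μ ≤
        C * ENNReal.ofReal s ^ (-α) * μ (ball x (16 * s)))
    (x : X) (s R : ℝ) (hs : 0 < s) (hR : 0 < R)
    (hsd : ENNReal.ofReal s < 2 * EMetric.diam (univ : Set X)) :
    ∫⁻ y in {y : X | infDist y E < s} ∩ ball x R, distWeight E α y ∂μ ≤
      C * K * ∫⁻ y in {y : X | l * s ≤ infDist y E ∧ infDist y E < s} ∩ ball x (R + 3 * s),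
        distWeight E α y ∂μ := by
  obtain ⟨u, hut, hudisj, hucov⟩ :=
    Vitali.exists_disjoint_subfamily_covering_enlargement_closedBall
      (E ∩ ball x (R + s)) (fun a : X => a) (fun _ => s) s (fun _ _ => le_rfl) 5 (by norm_num)
  have hu1 : ∀ b : u, (b : X) ∈ E := fun b => (hut b.2).1
  have hu2 : ∀ b : u, dist (b : X) x < R + s := fun b => (hut b.2).2
  choose y hy1 hy2 hy3 using fun b : u => h b (hu1 b) s hs hsd
  have hbd : ∀ b : u, ball (y b) (l * s) ⊆ ball x (R + 3 * s) := fun b =>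
    (hy1 b).trans (ball_subset_ball' (by have := hu2 b; linarith))
  have hdisj : Pairwise (Function.onFun Disjoint fun b : u => ball (y b) (l * s)) := by
    intro a b hab
    have := hudisj a.2 b.2 (fun e => hab (Subtype.ext e))
    exact this.mono ((hy1 a).trans ball_subset_closedBall) ((hy1 b).trans ball_subset_closedBall)
  have hcount : Countable u := by
    have : IsFiniteMeasure (μ.restrict (ball x (R + 3 * s))) :=
      ⟨by rw [Measure.restrict_apply_univ]; exact (hballs _ _ (by positivity)).2⟩
    have := Measure.countable_meas_pos_of_disjoint_iUnion
      (μ := μ.restrict (ball x (R + 3 * s))) (As := fun b : u => ball (y b) (l * s))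
      (fun b => measurableSet_ball) hdisj
    rw [← Set.countable_univ_iff]
    refine this.mono fun b _ => ?_
    show 0 < (μ.restrict (ball x (R + 3 * s))) (ball (y b) (l * s))
    rw [Measure.restrict_apply measurableSet_ball, inter_eq_self_of_subset_left (hbd b)]
    exact (hballs _ _ (by positivity)).1
  have hcov : {y : X | infDist y E < s} ∩ ball x R ⊆ ⋃ b : u, ball (b : X) (16 * s) := by
    rintro z ⟨hz, hzx⟩
    obtain ⟨e, he, hze⟩ := (infDist_lt_iff hE).1 hz
    have hex : e ∈ E ∩ ball x (R + s) := by
      refine ⟨he, ?_⟩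
      rw [mem_ball] at hzx ⊢
      have := dist_triangle e z x
      rw [dist_comm e z] at this
      linarith
    obtain ⟨b, hb, hsub⟩ := hucov e hex
    have : z ∈ closedBall b (5 * s) := hsub (mem_closedBall.2 hze.le)
    refine mem_iUnion.2 ⟨⟨b, hb⟩, ?_⟩
    rw [mem_closedBall] at this
    rw [mem_ball]
    show dist z b < _
    linarith
  have hone : ∀ b : u, ∫⁻ z in ball (b : X) (16 * s), distWeight E α z ∂μ ≤
      C * K * ∫⁻ z in ball (y b) (l * s), distWeight E α z ∂μ := by
    intro b
    have h1 : ENNReal.ofReal s ^ (-α) * μ (ball (y b) (l * s)) ≤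
        ∫⁻ z in ball (y b) (l * s), distWeight E α z ∂μ := by
      rw [← setLIntegral_const]
      refine setLIntegral_mono' measurableSet_ball fun z hz => le_dw hα ?_
      exact (infDist_le_dist_of_mem (hu1 b)).trans (mem_ball.1 (hy1 b hz)).le
    calc _ ≤ C * ENNReal.ofReal s ^ (-α) * μ (ball (b : X) (16 * s)) := hC b (hu1 b) s hs hsd
      _ ≤ C * ENNReal.ofReal s ^ (-α) * (K * μ (ball (y b) (l * s))) := by
        gcongr; exact hy3 b
      _ = C * K * (ENNReal.ofReal s ^ (-α) * μ (ball (y b) (l * s))) := by ring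
      _ ≤ _ := by gcongr
  calc _ ≤ ∫⁻ z in ⋃ b : u, ball (b : X) (16 * s), distWeight E α z ∂μ := lintegral_mono_set hcov
    _ ≤ ∑' b : u, ∫⁻ z in ball (b : X) (16 * s), distWeight E α z ∂μ := lintegral_iUnion_le _ _
    _ ≤ ∑' b : u, C * K * ∫⁻ z in ball (y b) (l * s), distWeight E α z ∂μ :=
        ENNReal.tsum_le_tsum hone
    _ = C * K * ∫⁻ z in ⋃ b : u, ball (y b) (l * s), distWeight E α z ∂μ := by
        rw [ENNReal.tsum_mul_left, lintegral_iUnion (fun _ => measurableSet_ball) hdisj]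
    _ ≤ _ := by
        gcongr
        refine iUnion_subset fun b z hz => ⟨⟨hy2 b z hz, ?_⟩, hbd b hz⟩
        exact (infDist_le_dist_of_mem (hu1 b)).trans_lt (mem_ball.1 (hy1 b hz))

lemma hole_step {μ : Measure X} {E : Set X} {α l : ℝ} (hl : l ≤ 1 / 2)
    {K : ℝ≥0∞} (hK : K ≠ ∞) {x : X} {s R : ℝ} (hs : 0 < s)
    (h : ∫⁻ y in {y : X | infDist y E < s} ∩ ball x R, distWeight E α y ∂μ ≤
      K * ∫⁻ y in {y : X | l * s ≤ infDist y E ∧ infDist y E < s} ∩ ball x (R + 3 * s),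
        distWeight E α y ∂μ) :
    ∫⁻ y in {y : X | infDist y E < l * s} ∩ ball x R, distWeight E α y ∂μ ≤
      (K / (K + 1)) * ∫⁻ y in {y : X | infDist y E < s} ∩ ball x (R + 3 * s),
        distWeight E α y ∂μ := by
  set I := ∫⁻ y in {y : X | infDist y E < l * s} ∩ ball x R, distWeight E α y ∂μ with hI
  set I2 := ∫⁻ y in {y : X | infDist y E < l * s} ∩ ball x (R + 3 * s), distWeight E α y ∂μ with hI2
  set J := ∫⁻ y in {y : X | l * s ≤ infDist y E ∧ infDist y E < s} ∩ ball x (R + 3 * s),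
        distWeight E α y ∂μ with hJ
  set M := ∫⁻ y in {y : X | infDist y E < s} ∩ ball x (R + 3 * s), distWeight E α y ∂μ with hM
  have hls : l * s ≤ s := by nlinarith
  have h1 : I ≤ K * J := by
    refine le_trans (lintegral_mono_set ?_) h
    exact inter_subset_inter_left _ fun z hz => lt_of_lt_of_le hz hls
  have h2 : I ≤ I2 := lintegral_mono_set
    (inter_subset_inter_right _ (ball_subset_ball (by linarith)))
  have hmeas : MeasurableSet ({y : X | l * s ≤ infDist y E ∧ infDist y E < s} ∩
      ball x (R + 3 * s)) := by
    refine MeasurableSet.inter ?_ measurableSet_ball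
    exact (measurableSet_le measurable_const measurable_infDist).inter
      (measurableSet_lt measurable_infDist measurable_const)
  have h3 : I2 + J ≤ M := by
    rw [hI2, hJ, ← lintegral_union hmeas]
    · refine lintegral_mono_set ?_
      rintro z (⟨hz, hz2⟩ | ⟨hz, hz2⟩)
      · exact ⟨lt_of_lt_of_le hz hls, hz2⟩
      · exact ⟨hz.2, hz2⟩
    · rw [Set.disjoint_left]
      rintro z ⟨hz, _⟩ ⟨hz2, _⟩
      exact absurd hz2.1 (not_le.2 hz)
  have h4 : (K + 1) * I ≤ K * M := by
    calc (K + 1) * I = K * I + I := by ring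
      _ ≤ K * I2 + K * J := by gcongr
      _ = K * (I2 + J) := by ring
      _ ≤ K * M := by gcongr
  have hK1 : K + 1 ≠ 0 := by simp
  have hK2 : K + 1 ≠ ∞ := by simpa using hK
  rw [ENNReal.div_eq_inv_mul, mul_assoc, ← ENNReal.div_eq_inv_mul,
    ENNReal.le_div_iff_mul_le (Or.inl hK1) (Or.inl hK2), mul_comm]
  exact h4

lemma hole_iter {l : ℝ} (hl0 : 0 < l) (hl : l ≤ 1 / 2) {θ : ℝ≥0∞}
    (I : ℝ → ℝ → ℝ≥0∞) (hmono : ∀ s R R', R ≤ R' → I s R ≤ I s R') {D : ℝ≥0∞}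
    (hstep : ∀ s R, 0 < s → 0 < R → ENNReal.ofReal s < D → I (l * s) R ≤ θ * I s (R + 3 * s))
    (k : ℕ) : ∀ s R, 0 < s → 0 < R → ENNReal.ofReal s < D →
      I (l ^ k * s) R ≤ θ ^ k * I s (R + 6 * s) := by
  induction k with
  | zero => intro s R hs hR hD; simpa using hmono _ _ _ (by linarith)
  | succ k ih =>
    intro s R hs hR hD
    have hls : l * s ≤ 1 / 2 * s := by gcongr
    have h1 := ih (l * s) R (by positivity) hR
      (lt_of_le_of_lt (ENNReal.ofReal_le_ofReal (by linarith)) hD)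
    have h2 := hstep s (R + 6 * (l * s)) hs (by positivity) hD
    have e : l ^ (k + 1) * s = l ^ k * (l * s) := by ring
    rw [e]
    calc _ ≤ _ := h1
      _ ≤ θ ^ k * (θ * I s (R + 6 * (l * s) + 3 * s)) := by gcongr
      _ ≤ θ ^ k * (θ * I s (R + 6 * s)) := by
          gcongr; exact hmono _ _ _ (by linarith)
      _ = _ := by ring

lemma exists_small_radius [Nontrivial X] :
    ∃ R : ℝ, 0 < R ∧ ENNReal.ofReal R < 2 * EMetric.diam (univ : Set X) := by
  obtain ⟨a, b, hab⟩ := exists_pair_ne X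
  refine ⟨dist a b, dist_pos.2 hab, ?_⟩
  rw [← edist_dist]
  have h1 : edist a b ≤ EMetric.diam (univ : Set X) :=
    Metric.edist_le_ediam_of_mem (mem_univ _) (mem_univ _)
  have h2 : edist a b < 2 * edist a b := by
    rw [two_mul]
    exact ENNReal.lt_add_right (edist_ne_top a b) (edist_pos.2 hab).ne'
  exact h2.trans_le (by gcongr)

lemma codim_bdd [Nontrivial X] {μ : Measure X} (hballs : BallsPosFinite μ) (hdbl : Doubling μ)
    {E : Set X} (hE : E.Nonempty) : BddAbove (assouadCodimBddSet μ E) := by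
  obtain ⟨C, hC0, hC⟩ := hdbl
  obtain ⟨x, hx⟩ := hE
  obtain ⟨R, hR, hRd⟩ := exists_small_radius (X := X)
  refine ⟨Real.logb 2 C, ?_⟩
  rintro ρ ⟨hρ, A, hA, h⟩
  rw [Real.le_logb_iff_rpow_le one_lt_two hC0]
  by_contra! hlt
  have hm := hballs x R hR
  set a := C / 2 ^ ρ with ha
  have ha0 : 0 ≤ a := by positivity
  have ha1 : a < 1 := by rw [ha, div_lt_one (by positivity)]; exact hlt
  obtain ⟨n, hn⟩ := exists_pow_lt_of_lt_one (show 0 < A⁻¹ by positivity) ha1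
  have hn' : a ^ (n + 1) < A⁻¹ := lt_of_le_of_lt (pow_le_pow_of_le_one ha0 ha1.le (Nat.le_succ n)) hn
  set r := R / 2 ^ (n + 1) with hr
  have hr0 : 0 < r := by positivity
  have hrR : r < R := div_lt_self hR (one_lt_pow₀ one_lt_two (Nat.succ_ne_zero n))
  have h1 := h x hx r R hr0 hrR hRd
  have h2 := doubling_pow hC (n + 1) x hr0
  have e1 : 2 ^ (n + 1) * r = R := by rw [hr]; field_simp
  rw [e1] at h2
  have h3 : μ (ball x r) ≤ μ ({y : X | infDist y E < r} ∩ ball x R) := by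
    refine measure_mono fun z hz => ⟨?_, ball_subset_ball hrR.le hz⟩
    exact (infDist_le_dist_of_mem hx).trans_lt hz
  have e2 : C ^ (n + 1) * (A * (r / R) ^ ρ) = A * a ^ (n + 1) := by
    have : r / R = (2 ^ (n + 1))⁻¹ := by rw [hr]; field_simp
    rw [this, Real.inv_rpow (by positivity), ← Real.rpow_natCast, ← Real.rpow_natCast,
      ← Real.rpow_natCast, ← Real.rpow_mul zero_le_two, ha, Real.div_rpow hC0.le (by positivity),
      ← Real.rpow_mul zero_le_two, mul_comm ((n + 1 : ℕ) : ℝ) ρ]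
    field_simp
  have h4 : μ (ball x R) ≤ ENNReal.ofReal (A * a ^ (n + 1)) * μ (ball x R) := by
    calc _ ≤ _ := h2
      _ ≤ ENNReal.ofReal C ^ (n + 1) * (ENNReal.ofReal (A * (r / R) ^ ρ) * μ (ball x R)) := by
        gcongr; exact h3.trans h1
      _ = _ := by
        rw [← mul_assoc, ← ENNReal.ofReal_pow hC0.le, ← ENNReal.ofReal_mul (by positivity), e2]
  have h5 : ENNReal.ofReal (A * a ^ (n + 1)) < 1 := by
    rw [ENNReal.ofReal_lt_one]
    calc A * a ^ (n + 1) < A * A⁻¹ := by gcongr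
      _ = 1 := by field_simp
  have h6 : ENNReal.ofReal (A * a ^ (n + 1)) * μ (ball x R) < 1 * μ (ball x R) :=
    ENNReal.mul_lt_mul_left hm.1.ne' hm.2.ne h5
  rw [one_mul] at h6
  exact absurd h4 (not_le.2 h6)

lemma codim_of_Ap [Nontrivial X] {μ : Measure X} (hballs : BallsPosFinite μ) (hdbl : Doubling μ)
    {E : Set X} (hE : E.Nonempty) (hpor : IsPorous E)
    {α q : ℝ} (hα : 0 < α) (hq : 1 < q) (hA : MemAp μ (distWeight E α) q) :
    α < assouadCodim μ E := by
  obtain ⟨l, hl0, hl, K, hK0, hK, h⟩ := porous_ball hdbl hE hpor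
  obtain ⟨C, hC0, hC, hAik⟩ := aikawa_of_Ap hballs hα hq hA hl0 hK0 hK h
  obtain ⟨Cd, hCd0, hCd⟩ := hdbl
  have hCK0 : C * K ≠ 0 := mul_ne_zero hC0 hK0
  have hCK : C * K ≠ ∞ := ENNReal.mul_ne_top hC hK
  set θ := C * K / (C * K + 1) with hθ
  have hl1 : l < 1 := by linarith
  have hθ0 : θ ≠ 0 := by
    rw [hθ]; exact (ENNReal.div_pos hCK0 (by simp [hCK])).ne'
  have hθ1 : θ < 1 := by
    rw [hθ]
    refine ENNReal.div_lt_of_lt_mul ?_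
    rw [one_mul]
    exact ENNReal.lt_add_right hCK one_ne_zero
  have hθt : θ ≠ ∞ := hθ1.ne_top
  set t := θ.toReal with ht
  have ht0 : 0 < t := ENNReal.toReal_pos hθ0 hθt
  have ht1 : t < 1 := by
    have := (ENNReal.toReal_lt_toReal hθt ENNReal.one_ne_top).2 hθ1
    simpa using this
  set ε := Real.logb l t with hε
  have hε0 : 0 < ε := Real.logb_pos_of_base_lt_one hl0 hl1 ht0 ht1
  have hlε : l ^ ε = t := Real.rpow_logb hl0 hl1.ne ht0
  refine lt_of_lt_of_le (show α < α + ε by linarith) (le_csSup (codim_bdd hballs ⟨Cd, hCd0, hCd⟩ hE) ?_)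
  refine ⟨by positivity, max 1 (C.toReal * Cd ^ 4 * t⁻¹), le_max_left _ _, ?_⟩
  intro x hx r R hr hrR hRd
  have hR : 0 < R := hr.trans hrR
  obtain ⟨k, hk1, hk2⟩ := exists_nat_pow_near_of_lt_one (x := r / R) (y := l) (by positivity)
    ((div_le_one hR).2 hrR.le) hl0 hl1
  let I : ℝ → ℝ → ℝ≥0∞ := fun s R =>
    ∫⁻ y in {y : X | infDist y E < s} ∩ ball x R, distWeight E α y ∂μ
  have hiter := hole_iter (l := l) hl0 hl (θ := θ) I
    (fun s R R' hRR' => lintegral_mono_set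
      (inter_subset_inter_right _ (ball_subset_ball hRR')))
    (D := 2 * EMetric.diam (univ : Set X))
    (fun s R hs hR hsd => hole_step hl hCK hs
      (hole_fill hballs hE hα hl0 h hAik x s R hs hR hsd)) k R R hR hR hRd
  have h1 : ENNReal.ofReal r ^ (-α) * μ ({y : X | infDist y E < r} ∩ ball x R) ≤ I r R := by
    rw [← setLIntegral_const]
    refine setLIntegral_mono' ?_ fun z hz => le_dw hα (le_of_lt hz.1)
    exact (measurableSet_lt measurable_infDist measurable_const).inter measurableSet_ball
  have h2 : I r R ≤ I (l ^ k * R) R := by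
    refine lintegral_mono_set (inter_subset_inter_left _ fun z hz => ?_)
    refine lt_of_lt_of_le (show infDist z E < r from hz) ?_
    exact (div_le_iff₀ hR).1 hk2
  have h3 : I R (R + 6 * R) ≤ C * ENNReal.ofReal R ^ (-α) * (ENNReal.ofReal Cd ^ 4 * μ (ball x R)) := by
    calc I R (R + 6 * R) ≤ ∫⁻ y in ball x (16 * R), distWeight E α y ∂μ :=
          lintegral_mono_set (inter_subset_right.trans (ball_subset_ball (by linarith)))
      _ ≤ _ := hAik x hx R hR hRd
      _ ≤ _ := by
          gcongr
          have := doubling_pow hCd 4 x hR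
          norm_num at this ⊢
          exact this
  have htk : t ^ k ≤ t⁻¹ * (r / R) ^ ε := by
    have : t ^ (k + 1) ≤ (r / R) ^ ε := by
      calc t ^ (k + 1) = (l ^ (k + 1)) ^ ε := by
            rw [← hlε, ← Real.rpow_natCast, ← Real.rpow_natCast, ← Real.rpow_mul hl0.le,
              ← Real.rpow_mul hl0.le, mul_comm]
        _ ≤ _ := Real.rpow_le_rpow (by positivity) hk1.le hε0.le
    rw [pow_succ] at this
    rw [inv_mul_eq_div, le_div_iff₀ ht0]
    exact this
  have h4 : ENNReal.ofReal r ^ (-α) * μ ({y : X | infDist y E < r} ∩ ball x R) ≤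
      θ ^ k * (C * ENNReal.ofReal R ^ (-α) * (ENNReal.ofReal Cd ^ 4 * μ (ball x R))) :=
    h1.trans (h2.trans (hiter.trans (by gcongr)))
  have hθe : θ = ENNReal.ofReal t := (ENNReal.ofReal_toReal hθt).symm
  have hCe : C = ENNReal.ofReal C.toReal := (ENNReal.ofReal_toReal hC).symm
  have h5 : μ ({y : X | infDist y E < r} ∩ ball x R) ≤
      ENNReal.ofReal (r ^ α * (t ^ k * (C.toReal * R ^ (-α) * Cd ^ 4))) * μ (ball x R) := by
    have hc : 0 ≤ C.toReal := ENNReal.toReal_nonneg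
    calc μ ({y : X | infDist y E < r} ∩ ball x R)
        = ENNReal.ofReal (r ^ α) * (ENNReal.ofReal r ^ (-α) *
          μ ({y : X | infDist y E < r} ∩ ball x R)) := by
          rw [ENNReal.ofReal_rpow_of_pos hr, ← mul_assoc, ← ENNReal.ofReal_mul (by positivity),
            ← Real.rpow_add hr]
          simp
      _ ≤ ENNReal.ofReal (r ^ α) * (θ ^ k *
          (C * ENNReal.ofReal R ^ (-α) * (ENNReal.ofReal Cd ^ 4 * μ (ball x R)))) := by gcongr
      _ = _ := by
          rw [ENNReal.ofReal_mul (by positivity), ENNReal.ofReal_mul (by positivity),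
            ENNReal.ofReal_mul (by positivity), ENNReal.ofReal_mul hc,
            ENNReal.ofReal_pow ht0.le, ENNReal.ofReal_pow hCd0.le, ← hθe, ← hCe,
            ENNReal.ofReal_rpow_of_pos hR]
          ring
  refine h5.trans ?_
  gcongr ENNReal.ofReal ?_ * _
  have hc : 0 ≤ C.toReal := ENNReal.toReal_nonneg
  calc r ^ α * (t ^ k * (C.toReal * R ^ (-α) * Cd ^ 4))
      ≤ r ^ α * ((t⁻¹ * (r / R) ^ ε) * (C.toReal * R ^ (-α) * Cd ^ 4)) := by gcongr
    _ = (C.toReal * Cd ^ 4 * t⁻¹) * (r / R) ^ (α + ε) := by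
        rw [Real.rpow_add (by positivity), Real.div_rpow hr.le hR.le α, Real.rpow_neg hR.le]
        ring
    _ ≤ _ := by gcongr; exact le_max_right _ _

lemma aikawa_of_codim {μ : Measure X} {E : Set X} {α ρ : ℝ} (hα : 0 < α)
    (hρ : ρ ∈ assouadCodimBddSet μ E) (hαρ : α < ρ) :
    ∃ C : ℝ≥0∞, C ≠ ∞ ∧ ∀ x ∈ E, ∀ R : ℝ, 0 < R →
      ENNReal.ofReal R < 2 * EMetric.diam (univ : Set X) →
      ∫⁻ y in ball x R, distWeight E α y ∂μ ≤
        C * ENNReal.ofReal R ^ (-α) * μ (ball x R) := by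
  obtain ⟨hρ0, A, hA, h⟩ := hρ
  set b : ℝ≥0∞ := ENNReal.ofReal ((1 / 2) ^ (ρ - α)) with hb
  have hb1 : b < 1 := by
    rw [hb, ENNReal.ofReal_lt_one]
    exact Real.rpow_lt_one (by norm_num) (by norm_num) (by linarith)
  refine ⟨ENNReal.ofReal (A * 2 ^ (α + ρ)) * ∑' k : ℕ, b ^ k, ?_, ?_⟩
  · refine ENNReal.mul_ne_top ENNReal.ofReal_ne_top ?_
    rw [ENNReal.tsum_geometric, ENNReal.inv_ne_top]
    exact (tsub_pos_of_lt hb1).ne'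
  intro x hx R hR hRd
  let S : ℕ → Set X := fun k => {y : X | infDist y E ≤ R * (1 / 2) ^ k} ∩ ball x R
  let c : ℕ → ℝ≥0∞ := fun k => ENNReal.ofReal (R * (1 / 2) ^ (k + 1)) ^ (-α)
  have hSm : ∀ k, MeasurableSet (S k) := fun k =>
    (measurableSet_le measurable_infDist measurable_const).inter measurableSet_ball
  have hSμ : ∀ k, μ (S k) ≤ ENNReal.ofReal (A * (2 * (1 / 2) ^ k) ^ ρ) * μ (ball x R) := by
    intro k
    by_cases hk : 2 * (1 / 2 : ℝ) ^ k < 1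
    · have h1 := h x hx (2 * (1 / 2 : ℝ) ^ k * R) R (by positivity) (by nlinarith) hRd
      rw [mul_div_cancel_right₀ _ hR.ne'] at h1
      refine le_trans (measure_mono (inter_subset_inter_left _ fun z hz => ?_)) h1
      have hz' : infDist z E ≤ R * (1 / 2) ^ k := hz
      show infDist z E < _
      have : 0 < R * (1 / 2) ^ k := by positivity
      linarith
    · push Not at hk
      calc μ (S k) ≤ μ (ball x R) := measure_mono inter_subset_right
        _ = 1 * μ (ball x R) := (one_mul _).symm
        _ ≤ _ := by
          gcongr
          rw [ENNReal.one_le_ofReal]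
          exact one_le_mul_of_one_le_of_one_le hA (Real.one_le_rpow hk hρ0)
  have hpt : ∀ y ∈ ball x R, distWeight E α y ≤ ∑' k, (S k).indicator (fun _ => c k) y := by
    intro y hy
    rcases (infDist_nonneg (x := y) (s := E)).eq_or_lt with h0 | h0
    · have hall : ∀ k, c 0 ≤ (S k).indicator (fun _ => c k) y := by
        intro k
        rw [indicator_of_mem]
        · refine ennreal_rpow_anti (ENNReal.ofReal_le_ofReal ?_) hα.le
          gcongr R * ?_
          exact pow_le_pow_of_le_one (by norm_num) (by norm_num) (by omega)
        · refine ⟨?_, hy⟩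
          show infDist y E ≤ _
          rw [← h0]; positivity
      have hc0 : c 0 ≠ 0 :=
        (ENNReal.rpow_pos (by rw [ENNReal.ofReal_pos]; positivity) ENNReal.ofReal_ne_top).ne'
      have := ENNReal.tsum_le_tsum hall
      rw [ENNReal.tsum_const_eq_top_of_ne_zero hc0] at this
      exact le_top.trans this
    · have hyR : infDist y E < R := (infDist_le_dist_of_mem hx).trans_lt hy
      obtain ⟨k, hk1, hk2⟩ := exists_nat_pow_near_of_lt_one (x := infDist y E / R)
        (y := (1 / 2 : ℝ)) (by positivity) ((div_le_one hR).2 hyR.le) (by norm_num) (by norm_num)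
      rw [lt_div_iff₀ hR] at hk1
      rw [div_le_iff₀ hR] at hk2
      refine le_trans ?_ (ENNReal.le_tsum k)
      rw [indicator_of_mem (show y ∈ S k from ⟨by show infDist y E ≤ _; linarith, hy⟩)]
      exact dw_le hα (by linarith)
  calc _ ≤ ∫⁻ y in ball x R, ∑' k, (S k).indicator (fun _ => c k) y ∂μ :=
        setLIntegral_mono' measurableSet_ball hpt
    _ ≤ ∫⁻ y, ∑' k, (S k).indicator (fun _ => c k) y ∂μ := setLIntegral_le_lintegral _ _
    _ = ∑' k, c k * μ (S k) := by
        rw [lintegral_tsum fun k => (measurable_const.indicator (hSm k)).aemeasurable]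
        simp_rw [lintegral_indicator_const (hSm _)]
    _ ≤ ∑' k, (ENNReal.ofReal (A * 2 ^ (α + ρ)) * ENNReal.ofReal R ^ (-α) * μ (ball x R)) * b ^ k := by
        refine ENNReal.tsum_le_tsum fun k => ?_
        calc c k * μ (S k) ≤ c k * (ENNReal.ofReal (A * (2 * (1 / 2) ^ k) ^ ρ) * μ (ball x R)) := by
              gcongr; exact hSμ k
          _ = (c k * ENNReal.ofReal (A * (2 * (1 / 2) ^ k) ^ ρ)) * μ (ball x R) := by ring
          _ = (ENNReal.ofReal (A * 2 ^ (α + ρ)) * ENNReal.ofReal R ^ (-α) * b ^ k) *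
              μ (ball x R) := by
            congr 1
            show ENNReal.ofReal (R * (1 / 2) ^ (k + 1)) ^ (-α) * _ = _
            rw [ENNReal.ofReal_rpow_of_pos (by positivity), ENNReal.ofReal_rpow_of_pos hR, hb,
              ← ENNReal.ofReal_pow (by positivity), ← ENNReal.ofReal_mul (by positivity),
              ← ENNReal.ofReal_mul (by positivity), ← ENNReal.ofReal_mul (by positivity)]
            congr 1
            have e1 : (2 * (1 / 2 : ℝ) ^ k) = 2 ^ (1 - (k : ℝ)) := by
              rw [Real.rpow_sub two_pos, Real.rpow_one, Real.rpow_natCast]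
              simp [div_eq_mul_inv]
            have e2 : ((1 / 2 : ℝ) ^ (k + 1)) = 2 ^ (-((k : ℝ) + 1)) := by
              rw [Real.rpow_neg zero_le_two]
              rw [show ((k : ℝ) + 1) = ((k + 1 : ℕ) : ℝ) by push_cast; ring, Real.rpow_natCast]
              simp
            have e3 : ((1 / 2 : ℝ) ^ (ρ - α)) ^ k = 2 ^ (-(ρ - α) * k) := by
              rw [← Real.rpow_natCast, ← Real.rpow_mul (by norm_num), one_div,
                Real.inv_rpow zero_le_two, ← Real.rpow_neg zero_le_two]
              congr 1; ring
            rw [e1, e2, e3, Real.mul_rpow hR.le (by positivity), ← Real.rpow_mul zero_le_two,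
              ← Real.rpow_mul zero_le_two]
            have e4 : (2 : ℝ) ^ (-((k : ℝ) + 1) * -α) * 2 ^ ((1 - (k : ℝ)) * ρ) =
                2 ^ (α + ρ) * 2 ^ (-(ρ - α) * k) := by
              rw [← Real.rpow_add two_pos, ← Real.rpow_add two_pos]
              congr 1; ring
            linear_combination (R ^ (-α) * A) * e4
          _ = _ := by ring
    _ = _ := by rw [ENNReal.tsum_mul_left]; ring

lemma aikawa_all [Nontrivial X] {μ : Measure X} {E : Set X} {α : ℝ} {C : ℝ≥0∞}
    (h : ∀ x ∈ E, ∀ R : ℝ, 0 < R →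
      ENNReal.ofReal R < 2 * EMetric.diam (univ : Set X) →
      ∫⁻ y in ball x R, distWeight E α y ∂μ ≤
        C * ENNReal.ofReal R ^ (-α) * μ (ball x R)) (x : X) (hx : x ∈ E) (R : ℝ) (hR : 0 < R) :
    ∃ T : ℝ, 0 < T ∧ (∀ y ∈ ball x R, infDist y E ≤ T) ∧
      ∫⁻ y in ball x R, distWeight E α y ∂μ ≤
        C * ENNReal.ofReal T ^ (-α) * μ (ball x R) := by
  by_cases hRd : ENNReal.ofReal R < 2 * EMetric.diam (univ : Set X)
  · exact ⟨R, hR, fun y hy => (infDist_le_dist_of_mem hx).trans (mem_ball.1 hy).le,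
      h x hx R hR hRd⟩
  push Not at hRd
  set D := EMetric.diam (univ : Set X) with hD
  have hDt : D ≠ ∞ := by
    rintro e
    rw [e] at hRd
    simp at hRd
  have hD0 : 0 < D.toReal := by
    obtain ⟨a, b, hab⟩ := exists_pair_ne X
    have h1 : edist a b ≤ D := Metric.edist_le_ediam_of_mem (mem_univ _) (mem_univ _)
    exact ENNReal.toReal_pos ((edist_pos.2 hab).trans_le h1).ne' hDt
  have hDe : D = ENNReal.ofReal D.toReal := (ENNReal.ofReal_toReal hDt).symm
  set d := D.toReal with hd
  have hdist : ∀ y : X, dist y x ≤ d := by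
    intro y
    have h1 : edist y x ≤ D := Metric.edist_le_ediam_of_mem (mem_univ _) (mem_univ _)
    rw [edist_dist, hDe] at h1
    exact (ENNReal.ofReal_le_ofReal_iff hD0.le).1 h1
  have e2 : 2 * D = ENNReal.ofReal (2 * d) := by
    rw [ENNReal.ofReal_mul zero_le_two, ← hDe]; simp
  rw [e2, ENNReal.ofReal_le_ofReal_iff hR.le] at hRd
  have hb1 : ball x R = ball x (3 / 2 * d) := by
    ext y
    have := hdist y
    simp only [mem_ball]
    constructor <;> intro <;> linarith
  refine ⟨3 / 2 * d, by positivity, fun y _ => (infDist_le_dist_of_mem hx).trans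
    ((hdist y).trans (by linarith)), ?_⟩
  rw [hb1]
  refine h x hx _ (by positivity) ?_
  rw [e2, ENNReal.ofReal_lt_ofReal_iff (by positivity)]
  linarith

lemma A1_of_codim [Nontrivial X] {μ : Measure X} (hballs : BallsPosFinite μ) (hdbl : Doubling μ)
    {E : Set X} (hE : E.Nonempty) {α : ℝ} (hα : 0 < α) (hco : α < assouadCodim μ E) :
    MemA1 μ (distWeight E α) := by
  have hne : (assouadCodimBddSet μ E).Nonempty := by
    by_contra hne
    rw [not_nonempty_iff_eq_empty] at hne
    rw [assouadCodim, hne, Real.sSup_empty] at hco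
    linarith
  obtain ⟨ρ, hρ, hαρ⟩ := exists_lt_of_lt_csSup hne hco
  obtain ⟨C, hC, h⟩ := aikawa_of_codim hα hρ hαρ
  have hall := aikawa_all h
  have hint : ∀ (x : X) (r : ℝ), 0 < r → ∫⁻ y in ball x r, distWeight E α y ∂μ ≠ ∞ := by
    intro x r hr
    obtain ⟨e, he⟩ := hE
    have hR : 0 < r + dist x e := by positivity
    obtain ⟨T, hT, -, hle⟩ := hall e he (r + dist x e) hR
    refine ne_top_of_le_ne_top ?_
      ((lintegral_mono_set (ball_subset_ball' le_rfl)).trans hle)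
    refine ENNReal.mul_ne_top (ENNReal.mul_ne_top hC ?_) (hballs _ _ hR).2.ne
    rw [ENNReal.ofReal_rpow_of_pos hT]; exact ENNReal.ofReal_ne_top
  have hess : ∀ (x : X) (r t : ℝ), (∀ y ∈ ball x r, infDist y E ≤ t) →
      essSup (fun y => (distWeight E α y)⁻¹) (μ.restrict (ball x r)) ≤
        (ENNReal.ofReal t ^ (-α))⁻¹ := by
    intro x r t ht
    refine essSup_le_of_ae_le _ (ae_restrict_of_forall_mem measurableSet_ball fun y hy => ?_)
    exact ENNReal.inv_le_inv.2 (le_dw hα (ht y hy))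
  refine ⟨⟨measurable_dw E α, ?_, hint⟩, ?_⟩
  · obtain ⟨e, he⟩ := hE
    have h1 : ∀ n : ℕ, ∀ᵐ y ∂(μ.restrict (ball e (n + 1 : ℝ))), distWeight E α y ≠ ∞ := by
      intro n
      filter_upwards [ae_lt_top (measurable_dw E α) (hint e (n + 1) (by positivity))] with y hy
      exact hy.ne
    have h2 := (ae_restrict_iUnion_iff (μ := μ) (fun n : ℕ => ball e (n + 1 : ℝ))
      (fun y => distWeight E α y ≠ ∞)).2 h1
    have h3 : (⋃ n : ℕ, ball e (n + 1 : ℝ)) = univ := by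
      refine eq_univ_of_forall fun y => mem_iUnion.2 ?_
      obtain ⟨n, hn⟩ := exists_nat_gt (dist y e)
      exact ⟨n, by rw [mem_ball]; linarith⟩
    rw [h3, Measure.restrict_univ] at h2
    filter_upwards [h2] with y hy
    exact ⟨dw_pos hα y, hy⟩
  obtain ⟨Cd, hCd0, hCd⟩ := hdbl
  have hK : C * ENNReal.ofReal Cd ^ 3 ≠ ∞ :=
    ENNReal.mul_ne_top hC (ENNReal.pow_ne_top ENNReal.ofReal_ne_top)
  refine ⟨(C * ENNReal.ofReal Cd ^ 3).toReal + 3 ^ α, by positivity, ?_⟩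
  rw [ENNReal.ofReal_add (by positivity) (by positivity), ENNReal.ofReal_toReal hK]
  intro x r hr
  have hm := hballs x r hr
  by_cases hx : 2 * r ≤ infDist x E
  · refine le_trans ?_ le_add_self
    set d := infDist x E with hd
    have hd0 : 0 < d := by linarith
    have h1 : ∀ y ∈ ball x r, d / 2 ≤ infDist y E := by
      intro y hy
      have := infDist_le_infDist_add_dist (s := E) (x := x) (y := y)
      rw [dist_comm] at this
      rw [mem_ball] at hy
      linarith
    have h2 : ∀ y ∈ ball x r, infDist y E ≤ 3 / 2 * d := by
      intro y hy
      have := infDist_le_infDist_add_dist (s := E) (x := y) (y := x)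
      rw [mem_ball] at hy
      linarith
    have h3 : (∫⁻ y in ball x r, distWeight E α y ∂μ) / μ (ball x r) ≤
        ENNReal.ofReal (d / 2) ^ (-α) := by
      refine ENNReal.div_le_of_le_mul ?_
      rw [← setLIntegral_const]
      exact setLIntegral_mono' measurableSet_ball fun y hy => dw_le hα (h1 y hy)
    refine (mul_le_mul' h3 (hess x r _ h2)).trans (le_of_eq ?_)
    rw [← ENNReal.rpow_neg, neg_neg, ENNReal.ofReal_rpow_of_pos (by positivity),
      ENNReal.ofReal_rpow_of_pos (by positivity), ← ENNReal.ofReal_mul (by positivity)]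
    congr 1
    rw [Real.rpow_neg (by positivity), ← Real.inv_rpow (by positivity),
      ← Real.mul_rpow (by positivity) (by positivity)]
    congr 1
    field_simp
  · refine le_trans ?_ le_self_add
    push Not at hx
    obtain ⟨e, he, hxe⟩ := (infDist_lt_iff hE).1 hx
    obtain ⟨T, hT, hT2, hle⟩ := hall e he (3 * r) (by positivity)
    have hsub : ball x r ⊆ ball e (3 * r) := ball_subset_ball' (by linarith)
    have hsub2 : ball e (3 * r) ⊆ ball x (2 ^ 3 * r) :=
      ball_subset_ball' (by rw [dist_comm]; linarith)
    have hTT0 : ENNReal.ofReal T ^ (-α) ≠ 0 :=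
      (ENNReal.rpow_pos (by rw [ENNReal.ofReal_pos]; exact hT) ENNReal.ofReal_ne_top).ne'
    have hTT : ENNReal.ofReal T ^ (-α) ≠ ∞ := by
      rw [ENNReal.ofReal_rpow_of_pos hT]; exact ENNReal.ofReal_ne_top
    have h3 : (∫⁻ y in ball x r, distWeight E α y ∂μ) / μ (ball x r) ≤
        C * ENNReal.ofReal Cd ^ 3 * ENNReal.ofReal T ^ (-α) := by
      refine ENNReal.div_le_of_le_mul ?_
      calc _ ≤ _ := lintegral_mono_set hsub
        _ ≤ _ := hle
        _ ≤ C * ENNReal.ofReal T ^ (-α) * (ENNReal.ofReal Cd ^ 3 * μ (ball x r)) := by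
          gcongr
          exact (measure_mono hsub2).trans (doubling_pow hCd 3 x hr)
        _ = _ := by ring
    refine (mul_le_mul' h3 (hess x r T fun y hy => hT2 y (hsub hy))).trans (le_of_eq ?_)
    rw [mul_assoc, ENNReal.mul_inv_cancel hTT0 hTT, mul_one]

lemma A2_of_A1 {μ : Measure X} (hballs : BallsPosFinite μ) {w : X → ℝ≥0∞}
    (h : MemA1 μ w) : MemAp μ w 2 := by
  obtain ⟨hw, A, hA, h⟩ := h
  refine ⟨hw, A, hA, fun x r hr => le_trans ?_ (h x r hr)⟩
  have e1 : -(1 / ((2 : ℝ) - 1)) = -1 := by norm_num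
  have e2 : (2 : ℝ) - 1 = 1 := by norm_num
  rw [e1, e2, ENNReal.rpow_one]
  gcongr
  refine ENNReal.div_le_of_le_mul ?_
  rw [← setLIntegral_const]
  refine lintegral_mono_ae ?_
  filter_upwards [ENNReal.ae_le_essSup (μ := μ.restrict (ball x r)) fun y => (w y)⁻¹] with y hy
  rwa [ENNReal.rpow_neg_one]

theorem distWeight_memA1_tfae_of_porous [Nontrivial X]
    (μ : Measure X) (hballs : BallsPosFinite μ) (hdbl : Doubling μ)
    (E : Set X) (hE : E.Nonempty) (hEc : IsClosed E) (hpor : IsPorous E)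
    (α : ℝ) (hα : 0 < α) :
    (α < assouadCodim μ E ↔ MemA1 μ (distWeight E α)) ∧
      (MemA1 μ (distWeight E α) ↔ ∃ q : ℝ, 1 < q ∧ MemAp μ (distWeight E α) q) := by
  have hAB : α < assouadCodim μ E → MemA1 μ (distWeight E α) :=
    A1_of_codim hballs hdbl hE hα
  have hBC : MemA1 μ (distWeight E α) → ∃ q : ℝ, 1 < q ∧ MemAp μ (distWeight E α) q :=
    fun h => ⟨2, one_lt_two, A2_of_A1 hballs h⟩
  have hCA : (∃ q : ℝ, 1 < q ∧ MemAp μ (distWeight E α) q) → α < assouadCodim μ E := by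
    rintro ⟨q, hq, h⟩
    exact codim_of_Ap hballs hdbl hE hpor hα hq h
  exact ⟨⟨hAB, fun h => hCA (hBC h)⟩, ⟨hBC, fun h => hAB (hCA h)⟩⟩

end
end ApDistance
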